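/- Let η, μ, α, β > 0, set s = μ+α+β, and define F : [0,1] → ℝ by F(p) = ((1−p)μ + pβ)/s · ∫₀¹ exp(−ηp·(α²(1−t) + (μ+β)α·(−log t))/s²) · t^{μ/s − 1} dt. Then F(0) = 1 and F has a right derivative at 0 equal to β/μ − 1 − η·α(2μ+β)/(μ(2μ+α+β)), which also equals β/μ − 1 − (η α/μ)·(1 + α/(2μ+β))^{−1}. -/

import Mathlib

open MeasureTheory intervalIntegral

/-- The right-hand side `F(p)` of the fixed-point equation of the DOCS thermodynamic
limit, with `s = μ+α+β`:
`F(p) = ((1−p)μ + pβ)/s · ∫₀¹ exp(−ηp·(α²(1−t) + (μ+β)α·(−log t))/s²) · t^{μ/s − 1} dt`. -/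
noncomputable def docsF (eta mu alpha beta : ℝ) (p : ℝ) : ℝ :=
  ((1 - p) * mu + p * beta) / (mu + alpha + beta) *
    ∫ t in (0:ℝ)..1,
      Real.exp (-(eta * p * (alpha ^ 2 * (1 - t) + (mu + beta) * alpha * (-Real.log t)) /
        (mu + alpha + beta) ^ 2)) * t ^ (mu / (mu + alpha + beta) - 1)

lemma docs_aux_int (a k1 k2 : ℝ) (ha : 0 < a) (h1 : 0 ≤ k1) (h2 : 0 ≤ k2) :
    IntervalIntegrable (fun t : ℝ => (k1 * (1 - t) + k2 * (-Real.log t)) * t ^ (a - 1)) volume 0 1 ∧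
    ∫ t in (0:ℝ)..1, (k1 * (1 - t) + k2 * (-Real.log t)) * t ^ (a - 1)
      = k1 * (1 / a - 1 / (a + 1)) + k2 / a ^ 2 := by
  set H : ℝ → ℝ := fun t => k1 * (t ^ a / a - t ^ (a + 1) / (a + 1)) +
    k2 * (t ^ a / a ^ 2 - (t ^ a * Real.log (t ^ a)) / a ^ 2) with hH
  have c1 : Continuous (fun t : ℝ => t ^ a) := Real.continuous_rpow_const ha.le
  have c2 : Continuous (fun t : ℝ => t ^ (a + 1)) := Real.continuous_rpow_const (by linarith)
  have c3 : Continuous (fun t : ℝ => t ^ a * Real.log (t ^ a)) := Real.continuous_mul_log.comp c1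
  have cH : Continuous H := by
    rw [hH]; fun_prop
  have hd : ∀ t ∈ Set.Ioo (0:ℝ) 1,
      HasDerivAt H ((k1 * (1 - t) + k2 * (-Real.log t)) * t ^ (a - 1)) t := by
    intro t ht
    have d1 : HasDerivAt (fun t : ℝ => t ^ a) (a * t ^ (a - 1)) t :=
      Real.hasDerivAt_rpow_const (Or.inl ht.1.ne')
    have d2 : HasDerivAt (fun t : ℝ => t ^ (a + 1)) ((a + 1) * t ^ (a + 1 - 1)) t :=
      Real.hasDerivAt_rpow_const (Or.inl ht.1.ne')
    have hp : 0 < t ^ a := Real.rpow_pos_of_pos ht.1 a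
    have d3 := d1.mul (d1.log hp.ne')
    have := (((d1.div_const a).sub (d2.div_const (a + 1))).const_mul k1).add
      (((d1.div_const (a ^ 2)).sub (d3.div_const (a ^ 2))).const_mul k2)
    refine this.congr_deriv ?_
    have e : t ^ a = t * t ^ (a - 1) := by
      rw [Real.rpow_sub_one ht.1.ne']; field_simp [ht.1.ne']
    have hq : 0 < t ^ (a - 1) := Real.rpow_pos_of_pos ht.1 _
    rw [Real.log_rpow ht.1, add_sub_cancel_right, e]
    have := ht.1
    field_simp
    ring
  have hint : IntervalIntegrable
      (fun t : ℝ => (k1 * (1 - t) + k2 * (-Real.log t)) * t ^ (a - 1)) volume 0 1 := by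
    refine intervalIntegrable_deriv_of_nonneg (g := H) cH.continuousOn ?_ ?_
    · simpa using hd
    · intro t ht
      simp at ht
      have := Real.log_nonpos ht.1.le ht.2.le
      have hq : 0 < t ^ (a - 1) := Real.rpow_pos_of_pos ht.1 _
      have : 0 ≤ 1 - t := by linarith [ht.2]
      have : 0 ≤ -Real.log t := by linarith
      positivity
  refine ⟨hint, ?_⟩
  rw [integral_eq_sub_of_hasDerivAt_of_le zero_le_one cH.continuousOn hd hint]
  simp [hH, Real.zero_rpow ha.ne', Real.zero_rpow (by linarith : a + 1 ≠ 0)]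
  field_simp

lemma docs_aux_deriv (a k1 k2 : ℝ) (ha : 0 < a) (h1 : 0 ≤ k1) (h2 : 0 ≤ k2) :
    HasDerivWithinAt (fun p : ℝ => ∫ t in (0:ℝ)..1,
      Real.exp (-(p * (k1 * (1 - t) + k2 * (-Real.log t)))) * t ^ (a - 1))
      (-(k1 * (1 / a - 1 / (a + 1)) + k2 / a ^ 2)) (Set.Ici 0) 0 := by
  obtain ⟨hi, he⟩ := docs_aux_int a k1 k2 ha h1 h2
  set L : ℝ → ℝ := fun t => k1 * (1 - t) + k2 * (-Real.log t) with hL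
  have mL : Measurable L := by rw [hL]; fun_prop
  have hL0 : ∀ t ∈ Set.uIoc (0:ℝ) 1, 0 ≤ L t ∧ 0 ≤ t ^ (a - 1) := by
    intro t ht
    rw [Set.uIoc_of_le zero_le_one] at ht
    have := Real.log_nonpos ht.1.le ht.2
    have : 0 ≤ 1 - t := by linarith [ht.2]
    have : 0 ≤ -Real.log t := by linarith
    exact ⟨by rw [hL]; positivity, Real.rpow_nonneg ht.1.le _⟩
  have hr : IntervalIntegrable (fun t : ℝ => t ^ (a - 1)) volume 0 1 :=
    intervalIntegrable_rpow' (by linarith)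
  have hI : ∀ p : ℝ, 0 ≤ p → IntervalIntegrable
      (fun t : ℝ => Real.exp (-(p * L t)) * t ^ (a - 1)) volume 0 1 := by
    intro p hp
    refine hr.mono_fun (by fun_prop) ?_
    refine (ae_restrict_iff' measurableSet_uIoc).2 (Filter.Eventually.of_forall fun t ht => ?_)
    obtain ⟨x, y⟩ := hL0 t ht
    dsimp only
    rw [norm_mul, Real.norm_eq_abs, Real.abs_exp]
    refine mul_le_of_le_one_left (norm_nonneg _) ?_
    rw [Real.exp_le_one_iff]
    have := mul_nonneg hp x
    linarith
  rw [hasDerivWithinAt_iff_tendsto_slope, Set.Ici_sdiff_left, ← he, ← intervalIntegral.integral_neg]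
  have key : Filter.Tendsto (fun p : ℝ => ∫ t in (0:ℝ)..1,
      ((Real.exp (-(p * L t)) - 1) / p) * t ^ (a - 1)) (nhdsWithin 0 (Set.Ioi 0))
      (nhds (∫ t in (0:ℝ)..1, -(L t * t ^ (a - 1)))) := by
    refine intervalIntegral.tendsto_integral_filter_of_dominated_convergence
      (fun t => L t * t ^ (a - 1)) ?_ ?_ hi ?_
    · exact Filter.Eventually.of_forall fun p => by fun_prop
    · filter_upwards [self_mem_nhdsWithin] with p hp
      have hp : 0 < p := hp
      refine Filter.Eventually.of_forall fun t ht => ?_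
      obtain ⟨x, y⟩ := hL0 t ht
      rw [norm_mul, Real.norm_of_nonneg y]
      refine mul_le_mul_of_nonneg_right ?_ y
      have h1 : Real.exp (-(p * L t)) ≤ 1 := by
        rw [Real.exp_le_one_iff]
        have := mul_nonneg hp.le x
        linarith
      have h2 := Real.add_one_le_exp (-(p * L t))
      rw [norm_div, Real.norm_of_nonneg hp.le, Real.norm_of_nonpos (by linarith), div_le_iff₀ hp]
      linarith
    · refine Filter.Eventually.of_forall fun t ht => ?_
      have hd : HasDerivAt (fun p : ℝ => Real.exp (-(p * L t))) (-L t) 0 := by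
        have := (((hasDerivAt_id (0:ℝ)).mul_const (L t)).neg).exp
        simpa using this
      have := (hd.hasDerivWithinAt (s := Set.Ici 0))
      rw [hasDerivWithinAt_iff_tendsto_slope, Set.Ici_sdiff_left] at this
      have := this.mul_const (t ^ (a - 1))
      rw [← neg_mul]
      refine this.congr fun p => ?_
      simp [slope_def_field]
  refine key.congr' ?_
  filter_upwards [self_mem_nhdsWithin] with p hp
  have hp : 0 < p := hp
  rw [slope_def_field, ← intervalIntegral.integral_sub (hI p hp.le) (hI 0 le_rfl),
    ← intervalIntegral.integral_div]
  refine intervalIntegral.integral_congr fun t _ => ?_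
  simp
  ring

/-- `F(0) = 1` and `F` has a right derivative at `0` equal to
`β/μ − 1 − η·α(2μ+β)/(μ(2μ+α+β))`, which also equals
`β/μ − 1 − (ηα/μ)·(1 + α/(2μ+β))⁻¹`. -/
theorem stmt17 (eta mu alpha beta : ℝ)
    (heta : 0 < eta) (hmu : 0 < mu) (halpha : 0 < alpha) (hbeta : 0 < beta) :
    docsF eta mu alpha beta 0 = 1 ∧
    HasDerivWithinAt (docsF eta mu alpha beta)
      (beta / mu - 1 - eta * alpha * (2 * mu + beta) / (mu * (2 * mu + alpha + beta)))
      (Set.Ici 0) 0 ∧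
    beta / mu - 1 - eta * alpha * (2 * mu + beta) / (mu * (2 * mu + alpha + beta)) =
      beta / mu - 1 - eta * alpha / mu * (1 + alpha / (2 * mu + beta))⁻¹ := by
  have hs : 0 < mu + alpha + beta := by positivity
  have ha : 0 < mu / (mu + alpha + beta) := by positivity
  have h0 : ∫ t in (0:ℝ)..1, t ^ (mu / (mu + alpha + beta) - 1) = (mu + alpha + beta) / mu := by
    rw [integral_rpow (Or.inl (by linarith))]
    simp [Real.zero_rpow ha.ne']
  refine ⟨?_, ?_, ?_⟩
  · simp [docsF, h0]
    field_simp
  · have hG := docs_aux_deriv (mu / (mu + alpha + beta))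
      (eta * alpha ^ 2 / (mu + alpha + beta) ^ 2)
      (eta * ((mu + beta) * alpha) / (mu + alpha + beta) ^ 2) ha (by positivity) (by positivity)
    have hA : HasDerivWithinAt (fun p : ℝ => ((1 - p) * mu + p * beta) / (mu + alpha + beta))
        ((-1 * mu + 1 * beta) / (mu + alpha + beta)) (Set.Ici 0) 0 := by
      have hid := hasDerivWithinAt_id (0:ℝ) (Set.Ici 0)
      exact (((hid.const_sub 1).mul_const mu).add (hid.mul_const beta)).div_const _
    have hm := hA.mul hG
    have hf : docsF eta mu alpha beta = fun p => ((1 - p) * mu + p * beta) / (mu + alpha + beta) *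
        ∫ t in (0:ℝ)..1, Real.exp (-(p * (eta * alpha ^ 2 / (mu + alpha + beta) ^ 2 * (1 - t) +
          eta * ((mu + beta) * alpha) / (mu + alpha + beta) ^ 2 * (-Real.log t)))) *
          t ^ (mu / (mu + alpha + beta) - 1) := by
      funext p
      unfold docsF
      congr 1
      refine intervalIntegral.integral_congr fun t _ => ?_
      congr 2
      ring
    rw [hf]
    refine hm.congr_deriv ?_
    simp only [zero_mul, neg_zero, Real.exp_zero, one_mul, h0]
    have : mu / (mu + alpha + beta) + 1 = (2 * mu + alpha + beta) / (mu + alpha + beta) := by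
      field_simp; ring
    rw [this]
    have : 0 < 2 * mu + alpha + beta := by positivity
    field_simp
    ring
  · have : 0 < 2 * mu + beta := by positivity
    have : 1 + alpha / (2 * mu + beta) = (2 * mu + alpha + beta) / (2 * mu + beta) := by
      field_simp; ring
    rw [this]
    field_simp
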